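/- arXiv:2107.03499 — 2 statements merged into one kernel-verified Lean document; each statement's English description precedes it below -/
import Mathlib

section
/- Let m ≥ 2 be an integer, let p₁ : ℝ → ℝ be 2π-periodic and C², and let u₁ : ℝ → ℝ be 2π-periodic and continuous. Then there exist C > 0 and ε₁ > 0 such that for all ε ∈ [0, ε₁] and all t ∈ ℝ, | E^m(1 + ε p₁, id + ε u₁)(t) − ε · E₁₀(t) | ≤ C ε², where E₁₀(t) := (1/2) [ sin(π/m) ( p₁'(t + 2π/m) + p₁'(t − 2π/m) + 2 p₁'(t) + u₁(t + 2π/m) + u₁(t − 2π/m) − 2 u₁(t) ) + cos(π/m) ( p₁(t − 2π/m) − p₁(t + 2π/m) ) ]. Here 1 + ε p₁ denotes the function t ↦ 1 + ε p₁(t) and id + ε u₁ denotes t ↦ t + ε u₁(t). -/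
open Real

/-- The generating function `L_p(t,t')` of the billiard in the convex domain
with support function `p`. -/
noncomputable def genfun (p : ℝ → ℝ) (t t' : ℝ) : ℝ :=
  Real.sqrt (p t ^ 2 + deriv p t ^ 2 + p t' ^ 2 + deriv p t' ^ 2
    - 2 * p t * p t' * Real.cos (t - t')
    - 2 * p t * deriv p t' * Real.sin (t - t')
    + 2 * deriv p t * p t' * Real.sin (t - t')
    - 2 * deriv p t * deriv p t' * Real.cos (t - t'))

/-- The error function `E^m(p,u)(t) = ∂₁L_p(u(t), u(t+2π/m)) + ∂₂L_p(u(t−2π/m), u(t))`. -/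
noncomputable def errfun (m : ℕ) (p u : ℝ → ℝ) (t : ℝ) : ℝ :=
  deriv (fun s => genfun p s (u (t + 2 * Real.pi / m))) (u t)
    + deriv (fun s => genfun p (u (t - 2 * Real.pi / m)) s) (u t)

section

open Filter Topology Asymptotics Set

theorem ContDiffAt.isBigO_sub_sub_fderiv {E : Type*} [NormedAddCommGroup E] [NormedSpace ℝ E]
    {f : E → ℝ} (hf : ContDiffAt ℝ 2 f 0) :
    (fun v => f v - f 0 - fderiv ℝ f 0 v) =O[𝓝 0] fun v => ‖v‖ ^ 2 := by
  have h1 : ContDiffAt ℝ 1 (fderiv ℝ f) 0 := hf.fderiv_right (by norm_num)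
  obtain ⟨K, t, ht, hK⟩ := h1.exists_lipschitzOnWith
  have hd : ∀ᶠ v in 𝓝 (0 : E), DifferentiableAt ℝ f v :=
    (hf.eventually (by simp)).mono fun v hv => hv.differentiableAt (by norm_num)
  obtain ⟨r, hr, hball⟩ := Metric.mem_nhds_iff.1 (inter_mem ht hd)
  refine IsBigO.of_bound K ?_
  filter_upwards [Metric.ball_mem_nhds (0 : E) hr] with v hv
  have hv' : ‖v‖ < r := by simpa using hv
  have hsub : Metric.closedBall (0 : E) ‖v‖ ⊆ Metric.ball 0 r :=
    Metric.closedBall_subset_ball hv'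
  have := (convex_closedBall (0 : E) ‖v‖).norm_image_sub_le_of_norm_fderiv_le' (𝕜 := ℝ) (f := f)
    (φ := fderiv ℝ f 0) (C := K * ‖v‖) (x := 0) (y := v)
    (fun x hx => (hball (hsub hx)).2)
    (fun x hx => by
      refine (hK.norm_sub_le (hball (hsub hx)).1 (hball (Metric.mem_ball_self hr)).1).trans ?_
      gcongr
      simpa using hx) (by simp) (by simp)
  simpa [pow_two, mul_assoc] using this

/-- The argument of the square root in `genfun`, in terms of
`x = p t - 1`, `x' = p' t`, `y = p t' - 1`, `y' = p' t'` and `w = t' - t - θ`. -/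
noncomputable def sqChord (θ : ℝ) (v : ℝ × ℝ × ℝ × ℝ × ℝ) : ℝ :=
  (1 + v.1) ^ 2 + v.2.1 ^ 2 + (1 + v.2.2.1) ^ 2 + v.2.2.2.1 ^ 2
    - 2 * (1 + v.1) * (1 + v.2.2.1) * cos (θ + v.2.2.2.2)
    + 2 * (1 + v.1) * v.2.2.2.1 * sin (θ + v.2.2.2.2)
    - 2 * v.2.1 * (1 + v.2.2.1) * sin (θ + v.2.2.2.2)
    - 2 * v.2.1 * v.2.2.2.1 * cos (θ + v.2.2.2.2)

/-- The cosine of the angle between the tangent and the chord, in the variables of `sqChord`. -/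
noncomputable def chordCos (θ : ℝ) (v : ℝ × ℝ × ℝ × ℝ × ℝ) : ℝ :=
  (v.2.1 - (1 + v.2.2.1) * sin (θ + v.2.2.2.2) - v.2.2.2.1 * cos (θ + v.2.2.2.2))
    / √(sqChord θ v)

theorem contDiff_sqChord (θ : ℝ) : ContDiff ℝ 2 (sqChord θ) := by
  unfold sqChord
  fun_prop

theorem sqChord_zero {θ s : ℝ} (hcos : cos θ = 1 - 2 * s ^ 2) :
    sqChord θ 0 = (2 * s) ^ 2 := by
  simp [sqChord, hcos]
  ring

theorem chordCos_zero {θ s c : ℝ} (hs : 0 < s) (hsin : sin θ = 2 * s * c)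
    (hcos : cos θ = 1 - 2 * s ^ 2) : chordCos θ 0 = -c := by
  rw [chordCos, sqChord_zero hcos, sqrt_sq (by positivity)]
  simp [hsin]
  field_simp

theorem contDiffAt_chordCos {θ s : ℝ} (hs : 0 < s) (hcos : cos θ = 1 - 2 * s ^ 2) :
    ContDiffAt ℝ 2 (chordCos θ) 0 := by
  have h0 : sqChord θ 0 ≠ 0 := by rw [sqChord_zero hcos]; positivity
  unfold chordCos
  refine ContDiffAt.div (by fun_prop) ((contDiff_sqChord θ).contDiffAt.sqrt h0) ?_
  rw [sqChord_zero hcos, sqrt_sq (by positivity)]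
  positivity

theorem fderiv_chordCos_zero {θ s c : ℝ} (hs : 0 < s) (hsin : sin θ = 2 * s * c)
    (hcos : cos θ = 1 - 2 * s ^ 2) (hsc : s ^ 2 + c ^ 2 = 1) (v : ℝ × ℝ × ℝ × ℝ × ℝ) :
    fderiv ℝ (chordCos θ) 0 v =
      s / 2 * (v.2.1 + v.2.2.2.1 + v.2.2.2.2) + c / 2 * (v.1 - v.2.2.1) := by
  have h1 : HasDerivAt (fun ε : ℝ => chordCos θ (ε • v)) (fderiv ℝ (chordCos θ) 0 v) 0 := by
    have hd := ((contDiffAt_chordCos hs hcos).differentiableAt (by norm_num)).hasFDerivAt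
    have hl : HasDerivAt (fun ε : ℝ => ε • v) v 0 := by
      simpa using (hasDerivAt_id (0 : ℝ)).smul_const v
    have hd' : HasFDerivAt (chordCos θ) (fderiv ℝ (chordCos θ) 0) ((0 : ℝ) • v) := by
      simpa using hd
    exact hd'.comp_hasDerivAt (0 : ℝ) hl
  refine h1.unique ?_
  obtain ⟨x, x', y, y', w⟩ := v
  have e (q : ℝ) : HasDerivAt (fun ε : ℝ => ε * q) q 0 := by
    simpa using (hasDerivAt_id (0 : ℝ)).mul_const q
  have ea (q r : ℝ) : HasDerivAt (fun ε : ℝ => r + ε * q) q 0 := (e q).const_add r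
  have hS := (ea w θ).sin
  have hC := (ea w θ).cos
  have hN := ((e x').sub ((ea y 1).mul hS)).sub ((e y').mul hC)
  have hD := ((((((((ea x 1).pow 2).add ((e x').pow 2)).add ((ea y 1).pow 2)).add
    ((e y').pow 2)).sub ((((ea x 1).const_mul 2).mul (ea y 1)).mul hC)).add
    ((((ea x 1).const_mul 2).mul (e y')).mul hS)).sub
    ((((e x').const_mul 2).mul (ea y 1)).mul hS)).sub
    ((((e x').const_mul 2).mul (e y')).mul hC)
  have hq := hN.div (hD.sqrt ?_) ?_
  · refine hq.congr_deriv ?_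
    have hsq : √((2 * s) ^ 2) = 2 * s := sqrt_sq (by positivity)
    have hD1 : (1 : ℝ) + 1 - 2 * cos θ = (2 * s) ^ 2 := by rw [hcos]; ring
    simp [hD1, hsq]
    rw [hsin, hcos]
    field_simp
    have : c ^ 2 = 1 - s ^ 2 := by linarith
    ring_nf
    simp only [this]
    ring
  all_goals
    have hD1 : (1 : ℝ) + 1 - 2 * cos θ = (2 * s) ^ 2 := by rw [hcos]; ring
    simp [hD1]
    try rw [sqrt_sq (by positivity)]
    positivity

theorem genfun_comm (p : ℝ → ℝ) (a b : ℝ) : genfun p a b = genfun p b a := by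
  have h : a - b = -(b - a) := by ring
  unfold genfun
  rw [h, cos_neg, sin_neg]
  congr 1
  ring

theorem errfun_eq (m : ℕ) (p u : ℝ → ℝ) (t : ℝ) :
    errfun m p u t = deriv (fun s => genfun p s (u (t + 2 * π / m))) (u t)
      + deriv (fun s => genfun p s (u (t - 2 * π / m))) (u t) := by
  simp only [errfun, genfun_comm p (u (t - 2 * π / m))]

theorem genfun_one_add {p : ℝ → ℝ} (ε a b θ : ℝ) :
    genfun (fun s => 1 + ε * p s) a b =
      √(sqChord θ (ε * p a, ε * deriv p a, ε * p b, ε * deriv p b, b - a - θ)) := by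
  have h : a - b = -(b - a) := by ring
  simp only [genfun, sqChord, deriv_const_add', deriv_const_mul_field', add_sub_cancel]
  rw [h, cos_neg, sin_neg]
  congr 1
  ring

theorem hasDerivAt_genfun_one_add {p : ℝ → ℝ} (hp : ContDiff ℝ 2 p) (ε a b θ : ℝ)
    (h0 : sqChord θ (ε * p a, ε * deriv p a, ε * p b, ε * deriv p b, b - a - θ) ≠ 0) :
    HasDerivAt (fun s => genfun (fun s => 1 + ε * p s) s b)
      ((1 + ε * (p a + deriv (deriv p) a)) *
        chordCos θ (ε * p a, ε * deriv p a, ε * p b, ε * deriv p b, b - a - θ)) a := by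
  simp only [genfun_one_add _ _ _ θ]
  have h1 : HasDerivAt p (deriv p a) a := (hp.differentiable (by norm_num) a).hasDerivAt
  have h2 : HasDerivAt (deriv p) (deriv (deriv p) a) a :=
    ((hp.deriv' (n := 1)).differentiable (by norm_num) a).hasDerivAt
  have hx := (h1.const_mul ε).const_add 1
  have hx' := h2.const_mul ε
  have hw : HasDerivAt (fun s => θ + (b - s - θ)) (-1) a := by
    simpa using (((hasDerivAt_id a).const_sub b).sub_const θ).const_add θ
  have hS := hw.sin
  have hC := hw.cos
  have hD := (((((((hx.pow 2).add (hx'.pow 2)).add_const ((1 + ε * p b) ^ 2)).add_const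
    ((ε * deriv p b) ^ 2)).sub (((hx.const_mul 2).mul_const (1 + ε * p b)).mul hC)).add
    (((hx.const_mul 2).mul_const (ε * deriv p b)).mul hS)).sub
    (((hx'.const_mul 2).mul_const (1 + ε * p b)).mul hS)).sub
    (((hx'.const_mul 2).mul_const (ε * deriv p b)).mul hC)
  refine (hD.sqrt h0).congr_deriv ?_
  rw [chordCos, ← mul_div_assoc]
  have e : ∀ N N' Q : ℝ, N = 2 * N' → N / (2 * Q) = N' / Q := by
    rintro _ N' Q rfl
    exact mul_div_mul_left _ _ two_ne_zero
  refine e _ _ _ ?_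
  simp
  ring

theorem isBigO_one_comp_of_bound {α : Type*} {l : Filter α} {f : ℝ → ℝ} {M : ℝ}
    (hf : ∀ x, ‖f x‖ ≤ M) (g : α → ℝ) : (fun z => f (g z)) =O[l] fun _ => (1 : ℝ) :=
  IsBigO.of_bound M (Eventually.of_forall fun z => by simpa using hf (g z))

theorem isBigO_comp_add_mul_sub {α : Type*} {l : Filter α} {f : ℝ → ℝ} {M : ℝ}
    (hf : Differentiable ℝ f) (hM : ∀ x, ‖deriv f x‖ ≤ M) (g : α → ℝ) {ε u : α → ℝ}
    (hu : u =O[l] fun _ => (1 : ℝ)) :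
    (fun z => f (g z + ε z * u z) - f (g z)) =O[l] ε := by
  have h1 : (fun z => f (g z + ε z * u z) - f (g z)) =O[l] fun z => ε z * u z := by
    refine IsBigO.of_bound M (Eventually.of_forall fun z => ?_)
    simpa using convex_univ.norm_image_sub_le_of_norm_deriv_le (fun x _ => hf x)
      (fun x _ => hM x) (mem_univ (g z)) (mem_univ (g z + ε z * u z))
  refine h1.trans ?_
  simpa using (isBigO_refl ε l).mul hu

theorem isBigO_deriv_genfun_sub {p u : ℝ → ℝ} {M₀ M₁ M₂ M : ℝ} (hp : ContDiff ℝ 2 p)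
    (h₀ : ∀ x, ‖p x‖ ≤ M₀) (h₁ : ∀ x, ‖deriv p x‖ ≤ M₁) (h₂ : ∀ x, ‖deriv (deriv p) x‖ ≤ M₂)
    (hu : ∀ x, ‖u x‖ ≤ M) {θ s c : ℝ} (hs : 0 < s) (hsin : sin θ = 2 * s * c)
    (hcos : cos θ = 1 - 2 * s ^ 2) (hsc : s ^ 2 + c ^ 2 = 1) :
    (fun z : ℝ × ℝ =>
      deriv (fun x => genfun (fun x => 1 + z.1 * p x) x (z.2 + θ + z.1 * u (z.2 + θ)))
          (z.2 + z.1 * u z.2)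
        - (1 + z.1 * (p (z.2 + z.1 * u z.2) + deriv (deriv p) (z.2 + z.1 * u z.2))) *
          (-c + z.1 * (s / 2 * (deriv p z.2 + deriv p (z.2 + θ) + (u (z.2 + θ) - u z.2))
            + c / 2 * (p z.2 - p (z.2 + θ))))) =O[𝓝 0 ×ˢ ⊤] fun z => z.1 ^ 2 := by
  set l : Filter (ℝ × ℝ) := 𝓝 0 ×ˢ ⊤
  have hε : Tendsto (fun z : ℝ × ℝ => z.1) l (𝓝 0) := tendsto_fst
  have hε1 : (fun z : ℝ × ℝ => z.1) =O[l] fun _ => (1 : ℝ) := hε.isBigO_one ℝ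
  have hu1 (g : ℝ × ℝ → ℝ) := isBigO_one_comp_of_bound (l := l) hu g
  have hdp : Differentiable ℝ p := hp.differentiable (by norm_num)
  have hdp' : Differentiable ℝ (deriv p) := (hp.deriv' (n := 1)).differentiable (by norm_num)
  set a : ℝ × ℝ → ℝ := fun z => z.2 + z.1 * u z.2
  set b : ℝ × ℝ → ℝ := fun z => z.2 + θ + z.1 * u (z.2 + θ)
  set k : ℝ × ℝ → ℝ × ℝ × ℝ × ℝ × ℝ := fun z =>
    (p (a z), deriv p (a z), p (b z), deriv p (b z), u (z.2 + θ) - u z.2) with hk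
  have hk1 : k =O[l] fun _ => (1 : ℝ) :=
    (isBigO_one_comp_of_bound h₀ a).prod_left <| (isBigO_one_comp_of_bound h₁ a).prod_left <|
      (isBigO_one_comp_of_bound h₀ b).prod_left <| (isBigO_one_comp_of_bound h₁ b).prod_left <|
        (hu1 _).sub (hu1 _)
  have hv : (fun z => z.1 • k z) =O[l] fun z => z.1 := by
    simpa using (isBigO_refl (fun z : ℝ × ℝ => z.1) l).smul hk1
  have hv0 : Tendsto (fun z => z.1 • k z) l (𝓝 0) := hv.trans_tendsto hε
  have hvk (z : ℝ × ℝ) : (z.1 * p (a z), z.1 * deriv p (a z), z.1 * p (b z),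
      z.1 * deriv p (b z), b z - a z - θ) = z.1 • k z := by
    simp only [hk, Prod.smul_mk, smul_eq_mul, a, b]
    congr 4
    ring
  have hne : ∀ᶠ z in l, sqChord θ (z.1 • k z) ≠ 0 :=
    hv0.eventually <| (contDiff_sqChord θ).continuous.continuousAt.eventually_ne
      (by rw [sqChord_zero hcos]; positivity)
  have hG := ((contDiffAt_chordCos hs hcos).isBigO_sub_sub_fderiv.comp_tendsto hv0).trans
    (hv.norm_left.pow 2)
  simp only [Function.comp_def, chordCos_zero hs hsin hcos,
    fderiv_chordCos_zero hs hsin hcos hsc, Prod.smul_fst, Prod.smul_snd, smul_eq_mul] at hG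
  have hpa := isBigO_comp_add_mul_sub (ε := Prod.fst) hdp h₁ Prod.snd (hu1 Prod.snd)
  have hpb := isBigO_comp_add_mul_sub (ε := Prod.fst) hdp h₁ (fun z => z.2 + θ) (hu1 (·.2 + θ))
  have hpa' := isBigO_comp_add_mul_sub (ε := Prod.fst) hdp' h₂ Prod.snd (hu1 Prod.snd)
  have hpb' := isBigO_comp_add_mul_sub (ε := Prod.fst) hdp' h₂ (fun z => z.2 + θ) (hu1 (·.2 + θ))
  have hlin := (isBigO_refl (fun z : ℝ × ℝ => z.1) l).mul
    (((hpa'.add hpb').const_mul_left (s / 2)).add ((hpa.sub hpb).const_mul_left (c / 2)))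
  simp only [← pow_two] at hlin
  have hερ := hε1.mul
    ((isBigO_one_comp_of_bound (l := l) h₀ a).add (isBigO_one_comp_of_bound h₂ a))
  rw [mul_one] at hερ
  have hρ := (isBigO_refl (fun _ : ℝ × ℝ => (1 : ℝ)) l).add hερ
  have hfin := hρ.mul (hG.add hlin)
  simp only [one_mul] at hfin
  refine hfin.congr' ?_ EventuallyEq.rfl
  filter_upwards [hne] with z hz
  rw [← hvk] at hz
  rw [(hasDerivAt_genfun_one_add hp z.1 (a z) (b z) θ hz).deriv, hvk]
  simp only [hk, a, b]
  ring

theorem Function.Periodic.exists_norm_le {f : ℝ → ℝ} {c : ℝ} (hf : Function.Periodic f c)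
    (hc : c ≠ 0) (hcont : Continuous f) : ∃ M, ∀ x, ‖f x‖ ≤ M := by
  obtain ⟨M, hM⟩ := (hf.isBounded_of_continuous hc hcont).exists_norm_le
  exact ⟨M, fun x => hM _ (mem_range_self x)⟩

theorem Function.Periodic.deriv_of_real {f : ℝ → ℝ} {c : ℝ} (hf : Function.Periodic f c) :
    Function.Periodic (deriv f) c := fun x => by
  rw [← deriv_comp_add_const, hf.funext]

theorem isBigO_errfun_sub {m : ℕ} (hm : 2 ≤ m) {p₁ u₁ : ℝ → ℝ}
    (hp : ContDiff ℝ 2 p₁) (hpper : ∀ t, p₁ (t + 2 * π) = p₁ t)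
    (hu : Continuous u₁) (huper : ∀ t, u₁ (t + 2 * π) = u₁ t) :
    (fun z : ℝ × ℝ => errfun m (fun s => 1 + z.1 * p₁ s) (fun s => s + z.1 * u₁ s) z.2
      - z.1 * ((1 / 2) * (sin (π / m) *
            (deriv p₁ (z.2 + 2 * π / m) + deriv p₁ (z.2 - 2 * π / m) + 2 * deriv p₁ z.2
              + u₁ (z.2 + 2 * π / m) + u₁ (z.2 - 2 * π / m) - 2 * u₁ z.2)
          + cos (π / m) * (p₁ (z.2 - 2 * π / m) - p₁ (z.2 + 2 * π / m)))))
      =O[𝓝 0 ×ˢ ⊤] fun z => z.1 ^ 2 := by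
  have hπ : 2 * π ≠ 0 := by positivity
  have hp0 : Function.Periodic p₁ (2 * π) := hpper
  have hp' : ContDiff ℝ 1 (deriv p₁) := hp.deriv' (n := 1)
  obtain ⟨M₀, h₀⟩ := hp0.exists_norm_le hπ hp.continuous
  obtain ⟨M₁, h₁⟩ := hp0.deriv_of_real.exists_norm_le hπ hp'.continuous
  obtain ⟨M₂, h₂⟩ := hp0.deriv_of_real.deriv_of_real.exists_norm_le hπ
    (hp'.continuous_deriv le_rfl)
  obtain ⟨M, hM⟩ := Function.Periodic.exists_norm_le huper hπ hu
  have hm' : (2 : ℝ) ≤ m := by exact_mod_cast hm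
  have hs : 0 < sin (π / m) :=
    sin_pos_of_pos_of_lt_pi (by positivity) (div_lt_self pi_pos (by linarith))
  have hθ : 2 * π / m = 2 * (π / m) := by ring
  have hsc := sin_sq_add_cos_sq (π / m)
  have hsin : sin (2 * π / m) = 2 * sin (π / m) * cos (π / m) := by rw [hθ, sin_two_mul]
  have hcos : cos (2 * π / m) = 1 - 2 * sin (π / m) ^ 2 := by
    rw [hθ, cos_two_mul]; linarith
  have hplus := isBigO_deriv_genfun_sub hp h₀ h₁ h₂ hM hs hsin hcos hsc
  have hminus := isBigO_deriv_genfun_sub hp h₀ h₁ h₂ hM (θ := -(2 * π / m)) (c := -cos (π / m))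
    hs (by rw [sin_neg, hsin]; ring) (by rw [cos_neg, hcos]) (by rw [neg_sq, hsc])
  have hρ := (isBigO_one_comp_of_bound (l := 𝓝 0 ×ˢ ⊤) h₀
      fun z : ℝ × ℝ => z.2 + z.1 * u₁ z.2).add
    (isBigO_one_comp_of_bound h₂ fun z : ℝ × ℝ => z.2 + z.1 * u₁ z.2)
  have hE : (fun z : ℝ × ℝ => (1 / 2) * (sin (π / m) *
        (deriv p₁ (z.2 + 2 * π / m) + deriv p₁ (z.2 - 2 * π / m) + 2 * deriv p₁ z.2
          + u₁ (z.2 + 2 * π / m) + u₁ (z.2 - 2 * π / m) - 2 * u₁ z.2)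
      + cos (π / m) * (p₁ (z.2 - 2 * π / m) - p₁ (z.2 + 2 * π / m))))
      =O[𝓝 0 ×ˢ ⊤] fun _ => (1 : ℝ) := by
    have b0 (g : ℝ × ℝ → ℝ) := isBigO_one_comp_of_bound (l := 𝓝 0 ×ˢ ⊤) h₀ g
    have b1 (g : ℝ × ℝ → ℝ) := isBigO_one_comp_of_bound (l := 𝓝 0 ×ˢ ⊤) h₁ g
    have bu (g : ℝ × ℝ → ℝ) := isBigO_one_comp_of_bound (l := 𝓝 0 ×ˢ ⊤) hM g
    exact ((((((((b1 _).add (b1 _)).add ((b1 _).const_mul_left 2)).add (bu _)).add (bu _)).sub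
      ((bu _).const_mul_left 2)).const_mul_left _).add
        (((b0 _).sub (b0 _)).const_mul_left _)).const_mul_left _
  have hρE := (isBigO_refl (fun z : ℝ × ℝ => z.1 ^ 2) (𝓝 0 ×ˢ ⊤)).mul (hρ.mul hE)
  simp only [mul_one] at hρE
  refine ((hplus.add hminus).add hρE).congr_left fun z => ?_
  simp only [errfun_eq, sub_eq_add_neg]
  ring

end

/-- First-order Taylor expansion of the error function:
`E^m(1 + εp₁, id + εu₁) = ε·E₁₀ + O(ε²)` uniformly in `t`, where `E₁₀` is the
explicit first-order term. -/
theorem stmt_4 (m : ℕ) (hm : 2 ≤ m) (p₁ u₁ : ℝ → ℝ)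
    (hp : ContDiff ℝ 2 p₁) (hpper : ∀ t, p₁ (t + 2 * π) = p₁ t)
    (hu : Continuous u₁) (huper : ∀ t, u₁ (t + 2 * π) = u₁ t) :
    ∃ C > 0, ∃ ε₁ > 0, ∀ ε : ℝ, 0 ≤ ε → ε ≤ ε₁ → ∀ t : ℝ,
      |errfun m (fun s => 1 + ε * p₁ s) (fun s => s + ε * u₁ s) t
        - ε * ((1 / 2) * (Real.sin (π / m) *
              (deriv p₁ (t + 2 * π / m) + deriv p₁ (t - 2 * π / m) + 2 * deriv p₁ t
                + u₁ (t + 2 * π / m) + u₁ (t - 2 * π / m) - 2 * u₁ t)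
            + Real.cos (π / m) * (p₁ (t - 2 * π / m) - p₁ (t + 2 * π / m))))|
        ≤ C * ε ^ 2 := by
  obtain ⟨C, hC, hbound⟩ := (isBigO_errfun_sub hm hp hpper hu huper).exists_pos
  obtain ⟨δ, hδ, hball⟩ := Metric.eventually_nhds_iff.1 (Filter.mem_prod_top.1 hbound.bound)
  refine ⟨C, hC, δ / 2, half_pos hδ, fun ε hε0 hε t => ?_⟩
  have hdist : dist ε 0 < δ := by
    rw [dist_zero_right, norm_of_nonneg hε0]
    linarith
  simpa using hball hdist t
end

section
/- Let m ≥ 2 be an integer and ε₀ > 0. Let p₁ : ℝ → ℝ be 2π-periodic and C², let u₁ : ℝ → ℝ be 2π-periodic and continuous, and suppose that for each ε ∈ [0, ε₀) there are a 2π-periodic C² function p_ε and a continuous u_ε : ℝ → ℝ with u_ε(t + 2π) = u_ε(t) + 2π, such that sup_t ( |p_ε(t) − 1 − ε p₁(t)| + |p_ε'(t) − ε p₁'(t)| + |p_ε''(t) − ε p₁''(t)| ) = O(ε²), sup_t |u_ε(t) − t − ε u₁(t)| = O(ε²), and E^m(p_ε, u_ε)(t) = 0 for all t (i.e. the deformed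 domain admits a 1/m-rational caustic). Then the Fourier coefficients of p₁ satisfy p̂₁(k m) = 0 for every k ∈ ℤ \ {0}. -/
open Real

/-- The `k`-th Fourier coefficient of a 2π-periodic function `f`. -/
noncomputable def fourierCoef (f : ℝ → ℝ) (k : ℤ) : ℂ :=
  (1 / (2 * Real.pi)) * ∫ t in (0:ℝ)..(2 * Real.pi),
    (f t : ℂ) * Complex.exp (-Complex.I * k * t)

open Filter Topology Set

section FourierCoefficients

lemma continuous_fourierCoef_integrand {f : ℝ → ℝ} (hf : Continuous f) (k : ℤ) :
    Continuous fun t : ℝ => (f t : ℂ) * Complex.exp (-Complex.I * k * t) := by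
  fun_prop

lemma fourierCoef_add {f g : ℝ → ℝ} (hf : Continuous f) (hg : Continuous g) (k : ℤ) :
    fourierCoef (fun t => f t + g t) k = fourierCoef f k + fourierCoef g k := by
  unfold fourierCoef
  rw [← mul_add, ← intervalIntegral.integral_add
    ((continuous_fourierCoef_integrand hf k).intervalIntegrable _ _)
    ((continuous_fourierCoef_integrand hg k).intervalIntegrable _ _)]
  congr 2
  funext t
  push_cast
  ring

lemma fourierCoef_const_mul (c : ℝ) (f : ℝ → ℝ) (k : ℤ) :
    fourierCoef (fun t => c * f t) k = c * fourierCoef f k := by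
  unfold fourierCoef
  rw [mul_left_comm]
  congr 1
  rw [← intervalIntegral.integral_const_mul]
  congr 1
  funext t
  push_cast
  ring

lemma exp_neg_I_mul_int_mul_periodic (k : ℤ) :
    Function.Periodic (fun t : ℝ => Complex.exp (-Complex.I * k * t)) (2 * π) := by
  intro t
  refine Complex.exp_eq_exp_iff_exists_int.2 ⟨-k, ?_⟩
  push_cast
  ring

lemma fourierCoef_comp_add {f : ℝ → ℝ} (hf : ∀ t, f (t + 2 * π) = f t) (a : ℝ) (k : ℤ) :
    fourierCoef (fun t => f (t + a)) k = Complex.exp (Complex.I * k * a) * fourierCoef f k := by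
  have hper : Function.Periodic
      (fun t : ℝ => (f t : ℂ) * Complex.exp (-Complex.I * k * t)) (2 * π) := by
    intro t
    have := exp_neg_I_mul_int_mul_periodic k t
    simp only at this ⊢
    rw [hf, this]
  have hshift := hper.intervalIntegral_add_eq a 0
  rw [← zero_add (2 * π), ← zero_add a, add_assoc, add_comm a, ← add_assoc,
    ← intervalIntegral.integral_comp_add_right] at hshift
  simp only [zero_add] at hshift
  unfold fourierCoef
  rw [mul_left_comm, ← hshift]
  congr 1
  rw [← intervalIntegral.integral_const_mul]
  congr 1
  funext t
  rw [mul_left_comm, ← Complex.exp_add]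
  congr 2
  push_cast
  ring

lemma fourierCoef_deriv {f : ℝ → ℝ} (hf : ContDiff ℝ 1 f) (hper : ∀ t, f (t + 2 * π) = f t)
    (k : ℤ) : fourierCoef (deriv f) k = Complex.I * k * fourierCoef f k := by
  have hu : ∀ t : ℝ, HasDerivAt (fun t : ℝ => (f t : ℂ)) ((deriv f t : ℝ) : ℂ) t := fun t =>
    (hf.differentiable one_ne_zero t).hasDerivAt.ofReal_comp
  have hv : ∀ t : ℝ, HasDerivAt (fun t : ℝ => Complex.exp (-Complex.I * k * t))
      (-Complex.I * k * Complex.exp (-Complex.I * k * t)) t := by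
    intro t
    have h := (((hasDerivAt_id (t : ℂ)).const_mul (-Complex.I * k)).cexp).comp_ofReal
    simpa [mul_comm] using h
  have hderiv : Continuous (deriv f) := hf.continuous_deriv le_rfl
  have hparts := intervalIntegral.integral_deriv_mul_eq_sub (a := 0) (b := 2 * π)
    (fun t _ => hu t) (fun t _ => hv t)
    ((Complex.continuous_ofReal.comp hderiv).intervalIntegrable _ _)
    (Continuous.intervalIntegrable (by fun_prop) _ _)
  have hexp := exp_neg_I_mul_int_mul_periodic k 0
  have hf0 := hper 0
  simp only [zero_add] at hexp hf0
  rw [hexp, hf0, sub_self, intervalIntegral.integral_add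
    (Continuous.intervalIntegrable (by fun_prop) _ _)
    (Continuous.intervalIntegrable (by have := hf.continuous; fun_prop) _ _)] at hparts
  unfold fourierCoef
  rw [mul_left_comm]
  congr 1
  rw [← intervalIntegral.integral_const_mul, eq_neg_of_add_eq_zero_left hparts, ← intervalIntegral.integral_neg]
  congr 1
  funext t
  ring

lemma deriv_add_period {f : ℝ → ℝ} {c : ℝ} (hf : ∀ t, f (t + c) = f t) (t : ℝ) :
    deriv f (t + c) = deriv f t := by
  rw [← deriv_comp_add_const, funext hf]

end FourierCoefficients

section GeneratingFunction

/-- The component of the chord from `γ(t')` to `γ(t)` along the unit tangent at `γ(t)`,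
where `γ` is the boundary of the domain with support function `p`. -/
noncomputable def chordTangent (p : ℝ → ℝ) (t t' : ℝ) : ℝ :=
  deriv p t + p t' * Real.sin (t - t') - deriv p t' * Real.cos (t - t')

lemma genfun_comm_s10 (p : ℝ → ℝ) (t t' : ℝ) : genfun p t t' = genfun p t' t := by
  unfold genfun
  rw [← neg_sub t' t, Real.sin_neg, Real.cos_neg]
  congr 1
  ring

lemma hasDerivAt_genfun {p : ℝ → ℝ} (hp : ContDiff ℝ 2 p) {t t' : ℝ} (h : genfun p t t' ≠ 0) :
    HasDerivAt (fun s => genfun p s t')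
      ((p t + deriv (deriv p) t) * (chordTangent p t t' / genfun p t t')) t := by
  have hp0 : HasDerivAt p (deriv p t) t := (hp.differentiable two_ne_zero t).hasDerivAt
  have hp1 : HasDerivAt (deriv p) (deriv (deriv p) t) t :=
    ((hp.deriv' (n := 1)).differentiable one_ne_zero t).hasDerivAt
  have hd : HasDerivAt (fun s => s - t') 1 t := (hasDerivAt_id t).sub_const t'
  have hG := (((((((hp0.pow 2).add (hp1.pow 2)).add_const (p t' ^ 2)).add_const
    (deriv p t' ^ 2)).sub (((hp0.const_mul 2).mul_const (p t')).mul hd.cos)).sub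
    (((hp0.const_mul 2).mul_const (deriv p t')).mul hd.sin)).add
    (((hp1.const_mul 2).mul_const (p t')).mul hd.sin)).sub
    (((hp1.const_mul 2).mul_const (deriv p t')).mul hd.cos)
  have hL := hG.sqrt (fun h0 => h (by
    unfold genfun
    simp only [Pi.add_apply, Pi.sub_apply, Pi.mul_apply, Pi.pow_apply] at h0
    rw [h0, Real.sqrt_zero]))
  refine hL.congr_deriv ?_
  change _ / (2 * genfun p t t') = _
  unfold chordTangent
  field_simp
  simp
  ring

end GeneratingFunction

section Expansion

/-- A uniform first-order expansion may be evaluated along a continuous path of points. -/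
lemma hasDerivWithinAt_of_uniform_expansion {f : ℝ → ℝ → ℝ} {g w : ℝ → ℝ} {c C : ℝ}
    (hfg : ∀ᶠ ε in 𝓝[≥] (0 : ℝ), ∀ x, |f ε x - c - ε * g x| ≤ C * ε ^ 2)
    (hg : Continuous g) (hw : ContinuousWithinAt w (Ici 0) 0) :
    HasDerivWithinAt (fun ε => f ε (w ε)) (g (w 0)) (Ici 0) 0 := by
  have hf0 : f 0 (w 0) = c := by
    have := hfg.self_of_nhdsWithin self_mem_Ici (w 0)
    simp only [zero_mul, sub_zero, ne_eq, OfNat.ofNat_ne_zero, not_false_eq_true, zero_pow,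
      mul_zero, abs_nonpos_iff] at this
    linarith
  rw [hasDerivWithinAt_iff_tendsto_slope, Ici_sdiff_left]
  have hgw : Tendsto (fun ε => g (w ε)) (𝓝[>] 0) (𝓝 (g (w 0))) :=
    (hg.continuousAt.comp_continuousWithinAt hw).mono_left (nhdsWithin_mono _ Ioi_subset_Ici_self)
  have hlin : Tendsto (fun ε : ℝ => C * ε) (𝓝[>] 0) (𝓝 0) := by
    have : Continuous fun ε : ℝ => C * ε := by fun_prop
    simpa using (this.tendsto 0).mono_left nhdsWithin_le_nhds
  have hdiff : Tendsto (fun ε => slope (fun ε => f ε (w ε)) 0 ε - g (w ε)) (𝓝[>] 0) (𝓝 0) := by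
    refine squeeze_zero_norm' ?_ hlin
    filter_upwards [hfg.filter_mono (nhdsWithin_mono _ Ioi_subset_Ici_self), self_mem_nhdsWithin]
      with ε hε hpos
    have hpos : 0 < ε := hpos
    have heq : slope (fun ε => f ε (w ε)) 0 ε - g (w ε) =
        (f ε (w ε) - c - ε * g (w ε)) / ε := by
      rw [slope_def_field, hf0, sub_zero, sub_div _ (ε * _), mul_div_cancel_left₀ _ hpos.ne']
    rw [heq, Real.norm_eq_abs, abs_div, abs_of_pos hpos, div_le_iff₀ hpos]
    linarith [hε (w ε)]
  simpa using hdiff.add hgw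

/-- First-order variation at the unit circle of the cosine of the angle between a chord
and the tangent at its endpoint. -/
lemma hasDerivWithinAt_chordTangent_div_genfun {pf : ℝ → ℝ → ℝ} {x y : ℝ → ℝ}
    {a b a' b' ξ η : ℝ}
    (hx : HasDerivWithinAt x ξ (Ici 0) 0) (hy : HasDerivWithinAt y η (Ici 0) 0)
    (ha : HasDerivWithinAt (fun ε => pf ε (x ε)) a (Ici 0) 0)
    (hb : HasDerivWithinAt (fun ε => deriv (pf ε) (x ε)) b (Ici 0) 0)
    (ha' : HasDerivWithinAt (fun ε => pf ε (y ε)) a' (Ici 0) 0)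
    (hb' : HasDerivWithinAt (fun ε => deriv (pf ε) (y ε)) b' (Ici 0) 0)
    (ha0 : pf 0 (x 0) = 1) (hb0 : deriv (pf 0) (x 0) = 0)
    (ha0' : pf 0 (y 0) = 1) (hb0' : deriv (pf 0) (y 0) = 0)
    (hcos : Real.cos (x 0 - y 0) < 1) :
    (∀ᶠ ε in 𝓝[≥] (0 : ℝ), genfun (pf ε) (x ε) (y ε) ≠ 0) ∧
    HasDerivWithinAt
      (fun ε => chordTangent (pf ε) (x ε) (y ε) / genfun (pf ε) (x ε) (y ε))
      ((2 * (2 - 2 * Real.cos (x 0 - y 0)) *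
          (b + a' * Real.sin (x 0 - y 0) + (ξ - η - b') * Real.cos (x 0 - y 0))
        - 2 * Real.sin (x 0 - y 0) * ((a + a') * (1 - Real.cos (x 0 - y 0))
          + (ξ - η + b - b') * Real.sin (x 0 - y 0)))
        / (2 * √(2 - 2 * Real.cos (x 0 - y 0)) ^ 3)) (Ici 0) 0 := by
  have hd := hx.sub hy
  have hG := ((((((((ha.pow 2).add (hb.pow 2)).add (ha'.pow 2)).add
    (hb'.pow 2)).sub (((ha.const_mul 2).mul ha').mul hd.cos)).sub
    (((ha.const_mul 2).mul hb').mul hd.sin)).add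
    (((hb.const_mul 2).mul ha').mul hd.sin)).sub
    (((hb.const_mul 2).mul hb').mul hd.cos))
  have hT := (hb.add (ha'.mul hd.sin)).sub (hb'.mul hd.cos)
  have hG0 : 0 < 2 - 2 * Real.cos (x 0 - y 0) := by linarith
  have hL := hG.sqrt (by simp [ha0, hb0, ha0', hb0']; intro h; linarith)
  have hL0 : genfun (pf 0) (x 0) (y 0) = √(2 - 2 * Real.cos (x 0 - y 0)) := by
    simp only [genfun, ha0, hb0, ha0', hb0']
    congr 1
    ring
  have hpos : 0 < √(2 - 2 * Real.cos (x 0 - y 0)) := Real.sqrt_pos.2 hG0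
  have hne : genfun (pf 0) (x 0) (y 0) ≠ 0 := hL0 ▸ hpos.ne'
  refine ⟨hL.continuousWithinAt.eventually_ne hne, ?_⟩
  refine (hT.div hL hne).congr_deriv ?_
  change (_ * genfun (pf 0) (x 0) (y 0) - chordTangent (pf 0) (x 0) (y 0) *
    (_ / (2 * genfun (pf 0) (x 0) (y 0)))) / genfun (pf 0) (x 0) (y 0) ^ 2 = _
  have hsq := Real.sq_sqrt hG0.le
  rw [hL0, chordTangent, ha0', hb0, hb0']
  simp [ha0, hb0, ha0', hb0']
  set r := √(2 - 2 * Real.cos (x 0 - y 0))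
  rw [← hsq]
  field_simp
  ring

end Expansion

lemma cos_two_pi_div_lt_one {m : ℕ} (hm : 2 ≤ m) : Real.cos (2 * π / m) < 1 := by
  have hm' : (2 : ℝ) ≤ m := by exact_mod_cast hm
  have hpos : 0 < 2 * π / m := by positivity
  have hle : 2 * π / m ≤ π := by
    rw [div_le_iff₀ (by linarith)]
    nlinarith [Real.pi_pos]
  simpa using Real.cos_lt_cos_of_nonneg_of_le_pi le_rfl hle hpos

/-- If a deformation `p_ε = 1 + εp₁ + O(ε²)` (in `C²`) of the unit disc admits,
for each small `ε ≥ 0`, a `1/m`-rational caustic (witnessed by `u_ε` with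
`E^m(p_ε,u_ε) ≡ 0` and `u_ε = id + εu₁ + O(ε²)`), then the Fourier coefficients
of `p₁` satisfy `p̂₁(km) = 0` for all `k ≠ 0`. -/
theorem stmt_10 (m : ℕ) (hm : 2 ≤ m) (ε₀ : ℝ) (hε₀ : 0 < ε₀)
    (p₁ u₁ : ℝ → ℝ)
    (hp₁ : ContDiff ℝ 2 p₁) (hp₁per : ∀ t, p₁ (t + 2 * π) = p₁ t)
    (hu₁ : Continuous u₁) (hu₁per : ∀ t, u₁ (t + 2 * π) = u₁ t)
    (pf uf : ℝ → ℝ → ℝ)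
    (hpf : ∀ ε : ℝ, 0 ≤ ε → ε < ε₀ →
      ContDiff ℝ 2 (pf ε) ∧ ∀ t, pf ε (t + 2 * π) = pf ε t)
    (huf : ∀ ε : ℝ, 0 ≤ ε → ε < ε₀ →
      Continuous (uf ε) ∧ ∀ t, uf ε (t + 2 * π) = uf ε t + 2 * π)
    (hpapprox : ∃ C > 0, ∃ ε₁ > 0, ∀ ε : ℝ, 0 ≤ ε → ε ≤ ε₁ → ε < ε₀ → ∀ t : ℝ,
      |pf ε t - 1 - ε * p₁ t| + |deriv (pf ε) t - ε * deriv p₁ t|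
          + |deriv (deriv (pf ε)) t - ε * deriv (deriv p₁) t| ≤ C * ε ^ 2)
    (huapprox : ∃ C > 0, ∃ ε₁ > 0, ∀ ε : ℝ, 0 ≤ ε → ε ≤ ε₁ → ε < ε₀ → ∀ t : ℝ,
      |uf ε t - t - ε * u₁ t| ≤ C * ε ^ 2)
    (hcaustic : ∀ ε : ℝ, 0 ≤ ε → ε < ε₀ → ∀ t : ℝ, errfun m (pf ε) (uf ε) t = 0) :
    ∀ k : ℤ, k ≠ 0 → fourierCoef p₁ (k * m) = 0 := by
  obtain ⟨C, -, ε₁, hε₁, hp⟩ := hpapprox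
  obtain ⟨D, -, ε₂, hε₂, hu⟩ := huapprox
  have hsmall : ∀ᶠ ε in 𝓝[≥] (0 : ℝ), 0 ≤ ε ∧ ε ≤ ε₁ ∧ ε ≤ ε₂ ∧ ε < ε₀ := by
    filter_upwards [self_mem_nhdsWithin, nhdsWithin_le_nhds (Iio_mem_nhds hε₁),
      nhdsWithin_le_nhds (Iio_mem_nhds hε₂), nhdsWithin_le_nhds (Iio_mem_nhds hε₀)]
      with ε h0 h1 h2 h3
    exact ⟨h0, le_of_lt h1, le_of_lt h2, h3⟩
  have hp₁' : ContDiff ℝ 1 (deriv p₁) := hp₁.deriv'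
  have hp₁'' : Continuous (deriv (deriv p₁)) := hp₁'.continuous_deriv le_rfl
  have hP0 : ∀ᶠ ε in 𝓝[≥] (0 : ℝ), ∀ x, |pf ε x - 1 - ε * p₁ x| ≤ C * ε ^ 2 := by
    filter_upwards [hsmall] with ε ⟨h0, h1, _, h3⟩ x
    linarith [hp ε h0 h1 h3 x, abs_nonneg (deriv (pf ε) x - ε * deriv p₁ x),
      abs_nonneg (deriv (deriv (pf ε)) x - ε * deriv (deriv p₁) x)]
  have hP1 : ∀ᶠ ε in 𝓝[≥] (0 : ℝ), ∀ x,
      |deriv (pf ε) x - 0 - ε * deriv p₁ x| ≤ C * ε ^ 2 := by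
    filter_upwards [hsmall] with ε ⟨h0, h1, _, h3⟩ x
    rw [sub_zero]
    linarith [hp ε h0 h1 h3 x, abs_nonneg (pf ε x - 1 - ε * p₁ x),
      abs_nonneg (deriv (deriv (pf ε)) x - ε * deriv (deriv p₁) x)]
  have hP2 : ∀ᶠ ε in 𝓝[≥] (0 : ℝ), ∀ x,
      |deriv (deriv (pf ε)) x - 0 - ε * deriv (deriv p₁) x| ≤ C * ε ^ 2 := by
    filter_upwards [hsmall] with ε ⟨h0, h1, _, h3⟩ x
    rw [sub_zero]
    linarith [hp ε h0 h1 h3 x, abs_nonneg (pf ε x - 1 - ε * p₁ x),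
      abs_nonneg (deriv (pf ε) x - ε * deriv p₁ x)]
  have hU : ∀ᶠ ε in 𝓝[≥] (0 : ℝ), ∀ x, |(uf ε x - x) - 0 - ε * u₁ x| ≤ D * ε ^ 2 := by
    filter_upwards [hsmall] with ε ⟨h0, _, h2, h3⟩ x
    rw [sub_zero]
    exact hu ε h0 h2 h3 x
  have hP00 : ∀ x, pf 0 x = 1 := fun x => by
    simpa [sub_eq_zero] using hP0.self_of_nhdsWithin self_mem_Ici x
  have hP10 : ∀ x, deriv (pf 0) x = 0 := fun x => by
    simpa using hP1.self_of_nhdsWithin self_mem_Ici x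
  have hP20 : ∀ x, deriv (deriv (pf 0)) x = 0 := fun x => by
    simpa using hP2.self_of_nhdsWithin self_mem_Ici x
  have hU0 : ∀ x, uf 0 x = x := fun x => by
    simpa [sub_eq_zero] using hU.self_of_nhdsWithin self_mem_Ici x
  have dU : ∀ x, HasDerivWithinAt (fun ε => uf ε x) (u₁ x) (Ici 0) 0 := fun x => by
    simpa using (hasDerivWithinAt_of_uniform_expansion (w := fun _ => x) hU hu₁
      continuousWithinAt_const).add_const x
  have dP0 : ∀ x, HasDerivWithinAt (fun ε => pf ε (uf ε x)) (p₁ x) (Ici 0) 0 := fun x => by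
    simpa [hU0] using
      hasDerivWithinAt_of_uniform_expansion hP0 hp₁.continuous (dU x).continuousWithinAt
  have dP1 : ∀ x, HasDerivWithinAt (fun ε => deriv (pf ε) (uf ε x)) (deriv p₁ x)
      (Ici 0) 0 := fun x => by
    simpa [hU0] using
      hasDerivWithinAt_of_uniform_expansion hP1 hp₁'.continuous (dU x).continuousWithinAt
  have dP2 : ∀ x, HasDerivWithinAt (fun ε => deriv (deriv (pf ε)) (uf ε x))
      (deriv (deriv p₁) x) (Ici 0) 0 := fun x => by
    simpa [hU0] using
      hasDerivWithinAt_of_uniform_expansion hP2 hp₁'' (dU x).continuousWithinAt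
  set δ : ℝ := 2 * π / m with hδ
  have hcos : Real.cos δ < 1 := cos_two_pi_div_lt_one hm
  have hchord : ∀ x y, Real.cos (x - y) < 1 → _ := fun x y hxy =>
    hasDerivWithinAt_chordTangent_div_genfun (dU x) (dU y) (dP0 x) (dP1 x) (dP0 y) (dP1 y)
      (hP00 _) (hP10 _) (hP00 _) (hP10 _) (by simpa only [hU0] using hxy)
  simp only [hU0] at hchord
  have hlin : ∀ t, (1 - Real.cos δ) * (2 * deriv p₁ t + deriv p₁ (t + δ) + deriv p₁ (t + -δ)
      + u₁ (t + δ) + u₁ (t + -δ) - 2 * u₁ t)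
      = Real.sin δ * (p₁ (t + δ) - p₁ (t + -δ)) := by
    intro t
    have hsub₁ : t - (t + δ) = -δ := by ring
    have hsub₂ : t - (t + -δ) = δ := by ring
    obtain ⟨hne₁, hd₁⟩ := hchord t (t + δ) (by rwa [hsub₁, Real.cos_neg])
    obtain ⟨hne₂, hd₂⟩ := hchord t (t + -δ) (by rwa [hsub₂])
    rw [hsub₁, Real.cos_neg, Real.sin_neg] at hd₁
    rw [hsub₂] at hd₂
    have hcurv : ∀ᶠ ε in 𝓝[≥] (0 : ℝ),
        pf ε (uf ε t) + deriv (deriv (pf ε)) (uf ε t) ≠ 0 :=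
      ((dP0 t).add (dP2 t)).continuousWithinAt.eventually_ne (by simp [hP00, hP20])
    have hzero : (fun ε => chordTangent (pf ε) (uf ε t) (uf ε (t + δ))
          / genfun (pf ε) (uf ε t) (uf ε (t + δ))
        + chordTangent (pf ε) (uf ε t) (uf ε (t + -δ))
          / genfun (pf ε) (uf ε t) (uf ε (t + -δ))) =ᶠ[𝓝[≥] 0] fun _ => 0 := by
      filter_upwards [hsmall, hne₁, hne₂, hcurv] with ε ⟨h0, _, _, h3⟩ hn₁ hn₂ hc
      have hE := hcaustic ε h0 h3 t
      unfold errfun at hE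
      simp only [genfun_comm_s10 (pf ε) (uf ε (t - 2 * π / m))] at hE
      rw [← hδ, sub_eq_add_neg, (hasDerivAt_genfun (hpf ε h0 h3).1 hn₁).deriv,
        (hasDerivAt_genfun (hpf ε h0 h3).1 hn₂).deriv, ← mul_add] at hE
      exact (mul_eq_zero.1 hE).resolve_left hc
    have hsum := (uniqueDiffWithinAt_Ici (0 : ℝ)).eq_deriv _ (hd₁.add hd₂)
      ((hasDerivWithinAt_const (0 : ℝ) (Ici 0) (0 : ℝ)).congr_of_eventuallyEq_of_mem hzero
        self_mem_Ici)
    have hpos : 0 < √(2 - 2 * Real.cos δ) := Real.sqrt_pos.2 (by linarith)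
    rw [← add_div, div_eq_zero_iff] at hsum
    have hnum := hsum.resolve_right (by positivity)
    refine mul_left_cancel₀ (show 2 * (1 - Real.cos δ) ≠ 0 by
      intro h; linarith) ?_
    linear_combination hnum + (4 * u₁ t + 4 * deriv p₁ t - 2 * u₁ (t + δ) - 2 * u₁ (t + -δ)
      - 2 * deriv p₁ (t + δ) - 2 * deriv p₁ (t + -δ)) * Real.sin_sq_add_cos_sq δ
  intro k hk
  set n : ℤ := k * m with hn
  have hn0 : n ≠ 0 := mul_ne_zero hk (by exact_mod_cast (by lia : m ≠ 0))
  have hm0 : (m : ℂ) ≠ 0 := by exact_mod_cast (by lia : m ≠ 0)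
  have hexp : Complex.exp (Complex.I * n * δ) = 1 := by
    refine Complex.exp_eq_one_iff.2 ⟨k, ?_⟩
    rw [hn, hδ]
    push_cast
    field_simp
  have hexp' : Complex.exp (Complex.I * n * (-δ : ℝ)) = 1 := by
    rw [Complex.ofReal_neg, mul_neg, Complex.exp_neg, hexp, inv_one]
  have hshift : ∀ f : ℝ → ℝ, (∀ t, f (t + 2 * π) = f t) →
      fourierCoef (fun t => f (t + δ)) n = fourierCoef f n ∧
      fourierCoef (fun t => f (t + -δ)) n = fourierCoef f n := fun f hf => by
    rw [fourierCoef_comp_add hf, fourierCoef_comp_add hf, hexp, hexp', one_mul]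
    exact ⟨rfl, rfl⟩
  have hdper : ∀ t, deriv p₁ (t + 2 * π) = deriv p₁ t := deriv_add_period hp₁per
  have hcoef := congrArg (fun f => fourierCoef f n) (funext fun t => hlin t)
  have hc₀ : Continuous p₁ := hp₁.continuous
  have hc₁ : Continuous (deriv p₁) := hp₁'.continuous
  simp only [sub_eq_add_neg _ (2 * u₁ _), sub_eq_add_neg (p₁ _), ← neg_mul,
    neg_eq_neg_one_mul (p₁ _)] at hcoef
  rw [fourierCoef_const_mul, fourierCoef_const_mul,
    fourierCoef_add (by fun_prop) (by fun_prop), fourierCoef_add (by fun_prop) (by fun_prop),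
    fourierCoef_add (by fun_prop) (by fun_prop), fourierCoef_add (by fun_prop) (by fun_prop),
    fourierCoef_add (by fun_prop) (by fun_prop), fourierCoef_add (by fun_prop) (by fun_prop),
    fourierCoef_const_mul, fourierCoef_const_mul, fourierCoef_const_mul,
    (hshift p₁ hp₁per).1, (hshift p₁ hp₁per).2, (hshift u₁ hu₁per).1, (hshift u₁ hu₁per).2,
    (hshift _ hdper).1, (hshift _ hdper).2,
    fourierCoef_deriv (hp₁.of_le one_le_two) hp₁per] at hcoef
  have hc : ((1 - Real.cos δ : ℝ) : ℂ) ≠ 0 := by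
    exact_mod_cast (sub_pos.2 hcos).ne'
  have hfactor : (((1 - Real.cos δ : ℝ) : ℂ) * (4 * Complex.I * n)) * fourierCoef p₁ n = 0 := by
    push_cast at hcoef ⊢
    linear_combination hcoef
  have hn0' : (n : ℂ) ≠ 0 := by exact_mod_cast hn0
  exact (mul_eq_zero.1 hfactor).resolve_left
    (mul_ne_zero hc (mul_ne_zero (mul_ne_zero (by norm_num) Complex.I_ne_zero) hn0'))
end
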